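/- arXiv:math/0701133 — 2 statements merged into one kernel-verified Lean document; each statement's English description precedes it below -/
import Mathlib

section
/- Let α > 0 and f ∈ E. An element h ∈ E is a global minimizer of the functional h ↦ F(h, α) = ⟨K(Ph − f), Ph − f⟩ + α‖h‖² if and only if h solves the normal equation (P ∘ K ∘ P)h + α h = P(K f). Moreover, every solution h of this equation satisfies P h = h, i.e. h lies in the range of P. (Euler–Lagrange characterization from the proof of Lemma 7 of the paper, together with its formula (21').) -/
open RealInnerProductSpace

/-- Second-order expansion of the regularized functional around `h` in the direction `v`. -/
theorem regularized_functional_add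
    {E : Type*} [NormedAddCommGroup E] [InnerProductSpace ℝ E]
    (K P : E →L[ℝ] E)
    (hK_selfadj : ∀ x y : E, ⟪K x, y⟫ = ⟪x, K y⟫)
    (hP_selfadj : ∀ x y : E, ⟪P x, y⟫ = ⟪x, P y⟫)
    (α : ℝ) (f h v : E) :
    ⟪K (P (h + v) - f), P (h + v) - f⟫ + α * ‖h + v‖ ^ 2 =
      (⟪K (P h - f), P h - f⟫ + α * ‖h‖ ^ 2) +
        2 * ⟪P (K (P h)) + α • h - P (K f), v⟫ + (⟪K (P v), P v⟫ + α * ‖v‖ ^ 2) := by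
  have split : P (h + v) - f = (P h - f) + P v := by
    rw [map_add]; abel
  have cross : ⟪K (P v), P h - f⟫ = ⟪K (P h - f), P v⟫ := by
    rw [hK_selfadj, real_inner_comm]
  have grad : ⟪P (K (P h)) + α • h - P (K f), v⟫ = ⟪K (P h - f), P v⟫ + α * ⟪h, v⟫ := by
    rw [inner_sub_left, inner_add_left, real_inner_smul_left, hP_selfadj, hP_selfadj,
      map_sub, inner_sub_left]
    ring
  rw [split, grad, norm_add_sq_real, map_add, inner_add_left, inner_add_right, inner_add_right,
    cross]
  ring

/-- Euler–Lagrange characterization from the proof of Lemma 7 of the paper, together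
with formula (21'): `h` is a global minimizer of
`F(h, α) = ⟨K(Ph − f), Ph − f⟩ + α‖h‖²` if and only if `(P ∘ K ∘ P)h + α h = P(K f)`;
moreover every solution of this normal equation satisfies `P h = h`. -/
theorem processed_time_reversal_normal_equation
    {E : Type*} [NormedAddCommGroup E] [InnerProductSpace ℝ E] [CompleteSpace E]
    (K P : E →L[ℝ] E)
    (hK_selfadj : ∀ x y : E, ⟪K x, y⟫ = ⟪x, K y⟫)
    (hK_nonneg : ∀ x : E, 0 ≤ ⟪K x, x⟫)
    (hP_idem : ∀ x : E, P (P x) = P x)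
    (hP_selfadj : ∀ x y : E, ⟪P x, y⟫ = ⟪x, P y⟫)
    (α : ℝ) (hα : 0 < α) (f : E) :
    (∀ h : E,
      (∀ h' : E,
        ⟪K (P h - f), P h - f⟫ + α * ‖h‖ ^ 2 ≤
          ⟪K (P h' - f), P h' - f⟫ + α * ‖h'‖ ^ 2) ↔
      P (K (P h)) + α • h = P (K f)) ∧
    (∀ h : E, P (K (P h)) + α • h = P (K f) → P h = h) := by
  refine ⟨fun h => ⟨fun hmin => ?_, fun heq h' => ?_⟩, fun h heq => ?_⟩
  · set G := P (K (P h)) + α • h - P (K f) with hG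
    have nonneg : ∀ t : ℝ,
        0 ≤ (⟪K (P G), P G⟫ + α * ‖G‖ ^ 2) * (t * t) + 2 * ‖G‖ ^ 2 * t + 0 := by
      intro t
      have key := hmin (h + t • G)
      rw [regularized_functional_add K P hK_selfadj hP_selfadj, ← hG, map_smul, map_smul,
        real_inner_smul_left, real_inner_smul_right, real_inner_smul_right,
        real_inner_self_eq_norm_sq, norm_smul, mul_pow, Real.norm_eq_abs, sq_abs] at key
      linarith
    have disc := discrim_le_zero nonneg
    have zero : 2 * ‖G‖ ^ 2 = 0 := by
      rw [discrim] at disc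
      exact pow_eq_zero_iff two_ne_zero |>.mp (le_antisymm (by linarith) (sq_nonneg _))
    have norm_zero : ‖G‖ = 0 := by simpa using zero
    exact sub_eq_zero.mp (norm_eq_zero.mp norm_zero)
  · have expand := regularized_functional_add K P hK_selfadj hP_selfadj α f h (h' - h)
    rw [add_sub_cancel, sub_eq_zero.mpr heq, inner_zero_left] at expand
    have := hK_nonneg (P (h' - h))
    have : 0 ≤ α * ‖h' - h‖ ^ 2 := by positivity
    linarith
  · have smul_eq : α • h = P (K f - K (P h)) := by
      rw [map_sub, ← heq, add_sub_cancel_left]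
    have : α • P h = α • h := by
      rw [← map_smul, smul_eq, hP_idem]
    exact smul_right_injective E hα.ne' this
end

section
/- Let α ∈ (0,1), ω > 2(1 + ‖P∘K∘P‖) and f ∈ E. Define the sequence (hₙ) in E by h₀ = 0 and h_{n+1} = (1 − α/ω)hₙ − ω⁻¹ P(K(P hₙ)) + ω⁻¹ P(K f). Then (hₙ) converges in norm, and its limit h(α) is the unique solution of (P ∘ K ∘ P)h + α h = P(K f). (Convergence of the processed time reversal iteration; abstract form of the first assertion of Theorem 1 (Main F) of the paper.) -/
open RealInnerProductSpace Filter

/-- A nonnegative symmetric operator `A` with `‖A‖ ≤ ω` satisfies `‖A x‖² ≤ ω ⟪A x, x⟫`. -/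
theorem norm_sq_apply_le_mul_inner_of_nonneg
    {E : Type*} [NormedAddCommGroup E] [InnerProductSpace ℝ E] {A : E →L[ℝ] E}
    (hA_symm : ∀ x y : E, ⟪A x, y⟫ = ⟪x, A y⟫) (hA_nonneg : ∀ x : E, 0 ≤ ⟪A x, x⟫)
    {ω : ℝ} (hω : 0 < ω) (hA : ‖A‖ ≤ ω) (x : E) : ‖A x‖ ^ 2 ≤ ω * ⟪A x, x⟫ := by
  have hpos := hA_nonneg (ω • x - A x)
  have hexpand : ⟪A (ω • x - A x), ω • x - A x⟫
      = ω ^ 2 * ⟪A x, x⟫ - 2 * ω * ‖A x‖ ^ 2 + ⟪A (A x), A x⟫ := by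
    simp only [map_sub, map_smul, inner_sub_left, inner_sub_right, real_inner_smul_left,
      real_inner_smul_right, hA_symm (A x) x, real_inner_self_eq_norm_sq]
    ring
  have hbound : ⟪A (A x), A x⟫ ≤ ω * ‖A x‖ ^ 2 :=
    calc ⟪A (A x), A x⟫ ≤ ‖A (A x)‖ * ‖A x‖ := real_inner_le_norm _ _
      _ ≤ ω * ‖A x‖ * ‖A x‖ := by
        gcongr
        exact A.le_of_opNorm_le hA _
      _ = ω * ‖A x‖ ^ 2 := by ring
  have hmul : ω * ‖A x‖ ^ 2 ≤ ω * (ω * ⟪A x, x⟫) := by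
    rw [hexpand] at hpos
    linarith
  exact le_of_mul_le_mul_left hmul hω

/-- Damped Richardson step: for `A` symmetric and nonnegative with `‖A‖ ≤ ω`, the operator
`q - ω⁻¹ A` with `q ≥ 1/2` has norm at most `q`. -/
theorem norm_smul_sub_inv_smul_apply_le
    {E : Type*} [NormedAddCommGroup E] [InnerProductSpace ℝ E] {A : E →L[ℝ] E}
    (hA_symm : ∀ x y : E, ⟪A x, y⟫ = ⟪x, A y⟫) (hA_nonneg : ∀ x : E, 0 ≤ ⟪A x, x⟫)
    {ω q : ℝ} (hω : 0 < ω) (hA : ‖A‖ ≤ ω) (hq : 1 / 2 ≤ q) (x : E) :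
    ‖q • x - ω⁻¹ • A x‖ ≤ q * ‖x‖ := by
  have hq0 : 0 ≤ q := by linarith
  refine le_of_sq_le_sq ?_ (by positivity)
  have hcoercive : ω⁻¹ ^ 2 * ‖A x‖ ^ 2 ≤ ω⁻¹ * ⟪A x, x⟫ := by
    calc ω⁻¹ ^ 2 * ‖A x‖ ^ 2 ≤ ω⁻¹ ^ 2 * (ω * ⟪A x, x⟫) := by
          gcongr
          exact norm_sq_apply_le_mul_inner_of_nonneg hA_symm hA_nonneg hω hA x
      _ = ω⁻¹ * ⟪A x, x⟫ := by field_simp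
  have hcross : 0 ≤ (2 * q - 1) * (ω⁻¹ * ⟪A x, x⟫) :=
    mul_nonneg (by linarith) (mul_nonneg (by positivity) (hA_nonneg x))
  rw [norm_sub_sq_real, norm_smul, norm_smul, real_inner_smul_left, real_inner_smul_right,
    Real.norm_of_nonneg hq0, Real.norm_of_nonneg (inv_nonneg.2 hω.le), real_inner_comm]
  linarith

/-- Convergence of the processed time reversal iteration; abstract form of the first
assertion of Theorem 1 (Main F) of the paper: for `α ∈ (0,1)` and
`ω > 2(1 + ‖P∘K∘P‖)`, the iteration `h₀ = 0`,
`h_{n+1} = (1 − α/ω)hₙ − ω⁻¹ P(K(P hₙ)) + ω⁻¹ P(K f)` converges in norm, and its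
limit is the unique solution of `(P ∘ K ∘ P)h + α h = P(K f)`. -/
theorem processed_time_reversal_iteration_converges
    {E : Type*} [NormedAddCommGroup E] [InnerProductSpace ℝ E] [CompleteSpace E]
    (K P : E →L[ℝ] E)
    (hK_selfadj : ∀ x y : E, ⟪K x, y⟫ = ⟪x, K y⟫)
    (hK_nonneg : ∀ x : E, 0 ≤ ⟪K x, x⟫)
    (hP_idem : ∀ x : E, P (P x) = P x)
    (hP_selfadj : ∀ x y : E, ⟪P x, y⟫ = ⟪x, P y⟫)
    (α ω : ℝ) (hα : α ∈ Set.Ioo (0 : ℝ) 1)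
    (hω : ω > 2 * (1 + ‖P.comp (K.comp P)‖))
    (f : E) (h : ℕ → E) (h0 : h 0 = 0)
    (hrec : ∀ n : ℕ,
      h (n + 1) = (1 - α / ω) • h n - ω⁻¹ • P (K (P (h n))) + ω⁻¹ • P (K f)) :
    ∃ hlim : E, Tendsto h atTop (nhds hlim) ∧
      P (K (P hlim)) + α • hlim = P (K f) ∧
      ∀ x : E, P (K (P x)) + α • x = P (K f) → x = hlim := by
  obtain ⟨hα0, hα1⟩ := hα
  set A : E →L[ℝ] E := P.comp (K.comp P)
  have hA_apply (x : E) : P (K (P x)) = A x := rfl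
  have hA_symm (x y : E) : ⟪A x, y⟫ = ⟪x, A y⟫ := by
    rw [← hA_apply, ← hA_apply, hP_selfadj, hK_selfadj, hP_selfadj]
  have hA_nonneg (x : E) : 0 ≤ ⟪A x, x⟫ := by
    rw [← hA_apply, hP_selfadj]
    exact hK_nonneg _
  have hA_norm := norm_nonneg A
  have hω0 : 0 < ω := by linarith
  have hαω : α / ω ≤ 1 / 2 := by
    rw [div_le_iff₀ hω0]
    linarith
  have hαω0 : 0 < α / ω := div_pos hα0 hω0
  set T : E → E := fun x => (1 - α / ω) • x - ω⁻¹ • A x + ω⁻¹ • P (K f) with hT_def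
  have hT_contracting : ContractingWith (Real.toNNReal (1 - α / ω)) T := by
    refine ⟨Real.toNNReal_lt_one.2 (by linarith), LipschitzWith.of_dist_le_mul fun x y => ?_⟩
    have hdiff : T x - T y = (1 - α / ω) • (x - y) - ω⁻¹ • A (x - y) := by
      simp only [hT_def, map_sub, smul_sub]
      abel
    rw [Real.coe_toNNReal _ (by linarith), dist_eq_norm, dist_eq_norm, hdiff]
    exact norm_smul_sub_inv_smul_apply_le hA_symm hA_nonneg hω0 (by linarith) (by linarith) _
  have hT_fixed (x : E) : T x = x ↔ A x + α • x = P (K f) := by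
    have hresidual : T x - x = ω⁻¹ • (P (K f) - (A x + α • x)) := by
      simp only [hT_def]
      module
    rw [← sub_eq_zero, hresidual, smul_eq_zero_iff_right (inv_ne_zero hω0.ne'), sub_eq_zero,
      eq_comm]
  have h_iterate : h = fun n => T^[n] 0 := by
    funext n
    induction n with
    | zero => exact h0
    | succ n ih => rw [hrec, Function.iterate_succ_apply', ← ih, hA_apply]
  refine ⟨hT_contracting.fixedPoint T, ?_, ?_, fun x hx => ?_⟩
  · rw [h_iterate]
    exact hT_contracting.tendsto_iterate_fixedPoint 0
  · exact (hT_fixed _).1 hT_contracting.fixedPoint_isFixedPt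
  · exact hT_contracting.fixedPoint_unique ((hT_fixed x).2 hx)
end
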